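/- arXiv:0908.3592 — 2 statements merged into one kernel-verified Lean document; each statement's English description precedes it below -/
import Mathlib

section
/- The torsion of the Γ-linear connection ∇ satisfies, for all i, j: T(δ/δx^j, δ/δx^i) = Σ_r (L^r_{ij} − L^r_{ji}) · δ/δx^r + Σ_r R^r_{ij} · ∂/∂y^r, where R^r_{ij} := δN^r_i/δx^j − δN^r_j/δx^i. -/
noncomputable section
open scoped BigOperators

/-- The local model `E = ℝ × (Fin n → ℝ) × (Fin n → ℝ)` of the 1-jet space `J¹(ℝ,M)`,
with coordinates `(t, x, y)`. -/
abbrev E (n : ℕ) : Type := ℝ × (Fin n → ℝ) × (Fin n → ℝ)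

variable {n : ℕ}

/-- Partial derivative `∂f/∂t`. -/
def pT (f : E n → ℝ) (p : E n) : ℝ := fderiv ℝ f p (1, 0, 0)

/-- Partial derivative `∂f/∂x^i`. -/
def pX (f : E n → ℝ) (i : Fin n) (p : E n) : ℝ := fderiv ℝ f p (0, Pi.single i 1, 0)

/-- Partial derivative `∂f/∂y^i`. -/
def pY (f : E n → ℝ) (i : Fin n) (p : E n) : ℝ := fderiv ℝ f p (0, 0, Pi.single i 1)

/-- The adapted temporal frame field `δ/δt = ∂/∂t - Σ_j M^j ∂/∂y^j`. -/
def delT (M : E n → Fin n → ℝ) (p : E n) : E n := (1, 0, fun j => -(M p j))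

/-- The adapted spatial frame field `δ/δx^i = ∂/∂x^i - Σ_j N^j_i ∂/∂y^j`. -/
def delX (N : E n → Fin n → Fin n → ℝ) (i : Fin n) (p : E n) : E n :=
  (0, Pi.single i 1, fun j => -(N p i j))

/-- The vertical frame field `∂/∂y^i`. -/
def delY (i : Fin n) (p : E n) : E n := ((0 : ℝ), (0 : Fin n → ℝ), Pi.single i 1)

/-- The Lie bracket `[X,Y](p) = (DY)(p)(X(p)) - (DX)(p)(Y(p))` of vector fields on `E`. -/
def lieBr (X Y : E n → E n) (p : E n) : E n := fderiv ℝ Y p (X p) - fderiv ℝ X p (Y p)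

/-- `δf/δt := ∂f/∂t - Σ_k M^k ∂f/∂y^k`. -/
def dT (M : E n → Fin n → ℝ) (f : E n → ℝ) (p : E n) : ℝ :=
  pT f p - ∑ k, M p k * pY f k p

/-- `δf/δx^i := ∂f/∂x^i - Σ_k N^k_i ∂f/∂y^k`. -/
def dX (N : E n → Fin n → Fin n → ℝ) (f : E n → ℝ) (i : Fin n) (p : E n) : ℝ :=
  pX f i p - ∑ k, N p i k * pY f k p

/-- A d-vector field `X = a·δ/δt + Σ_i b^i·δ/δx^i + Σ_i c^i·∂/∂y^i`
given by its adapted components. -/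
structure DVF (n : ℕ) where
  a : E n → ℝ
  b : E n → Fin n → ℝ
  c : E n → Fin n → ℝ

/-- The actual vector field on `E` determined by the adapted components of a `DVF`. -/
def DVF.realize (M : E n → Fin n → ℝ) (N : E n → Fin n → Fin n → ℝ) (X : DVF n)
    (p : E n) : E n :=
  (X.a p, X.b p, fun j => X.c p j - X.a p * M p j - ∑ i, X.b p i * N p i j)

/-- The nine families of adapted coefficients of a Γ-linear connection `∇`:
`Ḡ¹₁₁, G^k_{i1}, G^{(k)(1)}_{(1)(i)1}, L̄¹_{1j}, L^k_{ij}, L^{(k)(1)}_{(1)(i)j},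
C̄^{1(1)}_{1(j)}, C^{k(1)}_{i(j)}, C^{(k)(1)(1)}_{(1)(i)(j)}`. -/
structure Conn (n : ℕ) where
  Gbar : E n → ℝ
  G : E n → Fin n → Fin n → ℝ
  Gv : E n → Fin n → Fin n → ℝ
  Lbar : E n → Fin n → ℝ
  L : E n → Fin n → Fin n → Fin n → ℝ
  Lv : E n → Fin n → Fin n → Fin n → ℝ
  Cbar : E n → Fin n → ℝ
  C : E n → Fin n → Fin n → Fin n → ℝ
  Cv : E n → Fin n → Fin n → Fin n → ℝ

/-- All nine coefficient families are smooth. -/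
def Conn.Smooth (K : Conn n) : Prop :=
  ContDiff ℝ (⊤ : ℕ∞) K.Gbar ∧ ContDiff ℝ (⊤ : ℕ∞) K.G ∧ ContDiff ℝ (⊤ : ℕ∞) K.Gv ∧ ContDiff ℝ (⊤ : ℕ∞) K.Lbar ∧
  ContDiff ℝ (⊤ : ℕ∞) K.L ∧ ContDiff ℝ (⊤ : ℕ∞) K.Lv ∧ ContDiff ℝ (⊤ : ℕ∞) K.Cbar ∧ ContDiff ℝ (⊤ : ℕ∞) K.C ∧
  ContDiff ℝ (⊤ : ℕ∞) K.Cv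

/-- Derivative `X(f)(p) := Df(p)(X(p))` of `f` along the realized vector field of `X`. -/
def Xder (M : E n → Fin n → ℝ) (N : E n → Fin n → Fin n → ℝ) (X : DVF n) (f : E n → ℝ)
    (p : E n) : ℝ := fderiv ℝ f p (X.realize M N p)

/-- The Γ-linear connection `∇_X W` in adapted components. -/
def nabla (M : E n → Fin n → ℝ) (N : E n → Fin n → Fin n → ℝ) (K : Conn n)
    (X W : DVF n) : DVF n where
  a := fun p => Xder M N X W.a p +
    W.a p * (X.a p * K.Gbar p + ∑ j, X.b p j * K.Lbar p j + ∑ j, X.c p j * K.Cbar p j)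
  b := fun p k => Xder M N X (fun q => W.b q k) p +
    ∑ i, W.b p i *
      (X.a p * K.G p k i + ∑ j, X.b p j * K.L p k i j + ∑ j, X.c p j * K.C p k i j)
  c := fun p k => Xder M N X (fun q => W.c q k) p +
    ∑ i, W.c p i *
      (X.a p * K.Gv p k i + ∑ j, X.b p j * K.Lv p k i j + ∑ j, X.c p j * K.Cv p k i j)

/-- The adapted frame field `δ/δt` as a `DVF`. -/
def frT : DVF n := ⟨fun _ => 1, fun _ => 0, fun _ => 0⟩

/-- The adapted frame field `δ/δx^i` as a `DVF`. -/
def frX (i : Fin n) : DVF n := ⟨fun _ => 0, fun _ => Pi.single i 1, fun _ => 0⟩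

/-- The adapted frame field `∂/∂y^i` as a `DVF`. -/
def frY (i : Fin n) : DVF n := ⟨fun _ => 0, fun _ => 0, fun _ => Pi.single i 1⟩

/-- Decomposition of an arbitrary vector field into adapted components. -/
def decomp (M : E n → Fin n → ℝ) (N : E n → Fin n → Fin n → ℝ) (V : E n → E n) : DVF n :=
  ⟨fun p => (V p).1, fun p => (V p).2.1,
   fun p j => (V p).2.2 j + (V p).1 * M p j + ∑ i, (V p).2.1 i * N p i j⟩

/-- The torsion `T(X,Y) := ∇_X Y - ∇_Y X - [X,Y]`. -/
def torsion (M : E n → Fin n → ℝ) (N : E n → Fin n → Fin n → ℝ) (K : Conn n)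
    (X Y : DVF n) (p : E n) : E n :=
  (nabla M N K X Y).realize M N p - (nabla M N K Y X).realize M N p -
    lieBr (X.realize M N) (Y.realize M N) p

/-- The curvature `R(X,Y)Z := ∇_X(∇_Y Z) - ∇_Y(∇_X Z) - ∇_{[X,Y]}Z`. -/
def curv (M : E n → Fin n → ℝ) (N : E n → Fin n → Fin n → ℝ) (K : Conn n)
    (X Y Z : DVF n) (p : E n) : E n :=
  (nabla M N K X (nabla M N K Y Z)).realize M N p -
    (nabla M N K Y (nabla M N K X Z)).realize M N p -
    (nabla M N K (decomp M N (lieBr (X.realize M N) (Y.realize M N))) Z).realize M N p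

/-- The field with adapted components `δ_{ki}` is the frame field `δ/δx^i`. -/
lemma realize_frX (M : E n → Fin n → ℝ) (N : E n → Fin n → Fin n → ℝ) (i : Fin n) :
    (frX i).realize M N = delX N i := by
  funext p
  simp [DVF.realize, frX, delX, Pi.single_apply]

/-- A horizontal spatial d-vector field is the combination of the frame fields `δ/δx^r`
given by its components. -/
lemma realize_horizontal (M : E n → Fin n → ℝ) (N : E n → Fin n → Fin n → ℝ)
    (b : E n → Fin n → ℝ) (p : E n) :
    (DVF.mk (fun _ => 0) b (fun _ => 0)).realize M N p = ∑ r, b p r • delX N r p := by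
  refine Prod.ext ?_ (Prod.ext ?_ ?_)
  · simp [DVF.realize, delX, Prod.fst_sum]
  · funext k
    simp [DVF.realize, delX, Prod.fst_sum, Prod.snd_sum, Finset.sum_apply, Pi.single_apply]
  · funext k
    simp [DVF.realize, delX, Prod.snd_sum, Finset.sum_apply]

/-- `∇_{δ/δx^j} δ/δx^i = Σ_k L^k_{ij} δ/δx^k`, in adapted components. -/
lemma nabla_frX_frX (M : E n → Fin n → ℝ) (N : E n → Fin n → Fin n → ℝ) (K : Conn n)
    (i j : Fin n) :
    nabla M N K (frX j) (frX i) = ⟨fun _ => 0, fun p k => K.L p k i j, fun _ => 0⟩ := by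
  simp only [nabla, frX, DVF.mk.injEq]
  refine ⟨?_, ?_, ?_⟩
  · funext p
    simp [Xder]
  · funext p k
    simp [Xder, Pi.single_apply]
  · funext p k
    simp [Xder]

/-- The derivative along the frame field `δ/δx^j` is the operator `δ/δx^j`. -/
lemma fderiv_apply_delX (N : E n → Fin n → Fin n → ℝ) (f : E n → ℝ) (j : Fin n) (p : E n) :
    fderiv ℝ f p (delX N j p) = dX N f j p := by
  have h : delX N j p = ((0, Pi.single j 1, 0) : E n)
      - ∑ k, N p j k • ((0, 0, Pi.single k 1) : E n) := by
    refine Prod.ext ?_ (Prod.ext ?_ ?_)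
    · simp [delX, Prod.fst_sum]
    · simp [delX, Prod.fst_sum, Prod.snd_sum]
    · funext k
      simp [delX, Prod.snd_sum, Finset.sum_apply, Pi.single_apply]
  rw [h, map_sub, map_sum]
  simp only [map_smul, smul_eq_mul]
  rfl

/-- The derivative of `δ/δx^i` is vertical, with components the derivatives of `-N^r_i`. -/
lemma fderiv_delX {N : E n → Fin n → Fin n → ℝ} {p : E n} (hN : DifferentiableAt ℝ N p)
    (i : Fin n) (v : E n) :
    fderiv ℝ (delX N i) p v = (0, 0, fun r => -fderiv ℝ (fun q => N q i r) p v) := by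
  have h (r : Fin n) : HasFDerivAt (fun q => -N q i r) (-fderiv ℝ (fun q => N q i r) p) p :=
    (differentiableAt_pi.1 (differentiableAt_pi.1 hN i) r).hasFDerivAt.neg
  have key : HasFDerivAt (delX N i) _ p :=
    (hasFDerivAt_const (0 : ℝ) p).prodMk
      ((hasFDerivAt_const (Pi.single i 1 : Fin n → ℝ) p).prodMk (hasFDerivAt_pi.2 h))
  rw [key.fderiv]
  rfl

/-- `T(δ/δx^j, δ/δx^i) = Σ_r (L^r_{ij} − L^r_{ji})·δ/δx^r + Σ_r R^r_{ij}·∂/∂y^r`,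
where `R^r_{ij} := δN^r_i/δx^j − δN^r_j/δx^i`. -/
theorem torsion_delX_delX (n : ℕ) (M : E n → Fin n → ℝ) (N : E n → Fin n → Fin n → ℝ)
    (hM : ContDiff ℝ (⊤ : ℕ∞) M) (hN : ContDiff ℝ (⊤ : ℕ∞) N) (K : Conn n) (hK : K.Smooth) (i j : Fin n) :
    torsion M N K (frX j) (frX i) = fun p =>
      (∑ r, (K.L p r i j - K.L p r j i) • delX N r p) +
        ∑ r, (dX N (fun q => N q i r) j p - dX N (fun q => N q j r) i p) • delY r p := by
  funext p
  have hNp : DifferentiableAt ℝ N p := hN.differentiable (by simp) p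
  simp only [torsion, nabla_frX_frX, realize_horizontal, realize_frX, lieBr, fderiv_delX hNp,
    fderiv_apply_delX, sub_smul, Finset.sum_sub_distrib]
  rw [sub_eq_add_neg _ (Prod.mk _ _ - _)]
  congr 1
  rw [← Finset.sum_sub_distrib]
  refine Prod.ext ?_ (Prod.ext ?_ ?_)
  · simp [delY, Prod.fst_sum]
  · simp [delY, Prod.fst_sum, Prod.snd_sum]
  · funext k
    simp [delY, Prod.snd_sum, Finset.sum_apply, Pi.single_apply]
    ring
end
end

section
/- Ricci identity (M-horizontal components, spatial–spatial derivatives): for any smooth d-vector components X¹, X^i, X^{(i)} : E → ℝ and all i, j, k, one has X^i_{|j|k} − X^i_{|k|j} = Σ_r X^r R^i_{rjk} − Σ_r X^i_{|r} T^r_{jk} − Σ_r X^i|_{(r)} R^r_{jk}, where T^r_{jk} := L^r_{jk} − L^r_{kj}, R^r_{jk} := δN^r_j/δx^k − δN^r_k/δx^j, and R^i_{rjk} := δL^i_{rj}/δx^k − δL^i_{rk}/δx^j + Σ_s (L^s_{rj} L^i_{sk} − L^s_{rk} L^i_{sj}) + Σ_s C^i_{rs} R^s_{jk}. -/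
noncomputable section
open scoped BigOperators

variable {n : ℕ}

/-- `X^i_{/1} := δX^i/δt + Σ_r X^r G^i_r`. -/
def covTx (M : E n → Fin n → ℝ) (K : Conn n) (Xs : E n → Fin n → ℝ) (i : Fin n)
    (p : E n) : ℝ :=
  dT M (fun q => Xs q i) p + ∑ r, Xs p r * K.G p i r

/-- `X^i_{|j} := δX^i/δx^j + Σ_r X^r L^i_{rj}`. -/
def covXx (N : E n → Fin n → Fin n → ℝ) (K : Conn n) (Xs : E n → Fin n → ℝ) (i j : Fin n)
    (p : E n) : ℝ :=
  dX N (fun q => Xs q i) j p + ∑ r, Xs p r * K.L p i r j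

/-- `X^i|_{(j)} := ∂X^i/∂y^j + Σ_r X^r C^i_{rj}`. -/
def covYx (K : Conn n) (Xs : E n → Fin n → ℝ) (i j : Fin n) (p : E n) : ℝ :=
  pY (fun q => Xs q i) j p + ∑ r, Xs p r * K.C p i r j

/-- `X^{(i)}_{/1} := δX^{(i)}/δt + Σ_r X^{(r)} Gv^i_r`. -/
def covTv (M : E n → Fin n → ℝ) (K : Conn n) (Xv : E n → Fin n → ℝ) (i : Fin n)
    (p : E n) : ℝ :=
  dT M (fun q => Xv q i) p + ∑ r, Xv p r * K.Gv p i r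

/-- `X^{(i)}_{|j} := δX^{(i)}/δx^j + Σ_r X^{(r)} Lv^i_{rj}`. -/
def covXv (N : E n → Fin n → Fin n → ℝ) (K : Conn n) (Xv : E n → Fin n → ℝ) (i j : Fin n)
    (p : E n) : ℝ :=
  dX N (fun q => Xv q i) j p + ∑ r, Xv p r * K.Lv p i r j

/-- `X^{(i)}|_{(j)} := ∂X^{(i)}/∂y^j + Σ_r X^{(r)} Cv^i_{rj}`. -/
def covYv (K : Conn n) (Xv : E n → Fin n → ℝ) (i j : Fin n) (p : E n) : ℝ :=
  pY (fun q => Xv q i) j p + ∑ r, Xv p r * K.Cv p i r j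

/-- The d-tensor `R^r_{1k} := δM^r/δx^k − δN^r_k/δt`. -/
def Rtime (M : E n → Fin n → ℝ) (N : E n → Fin n → Fin n → ℝ) (r k : Fin n) (p : E n) : ℝ :=
  dX N (fun q => M q r) k p - dT M (fun q => N q k r) p

/-- The d-tensor `R^r_{jk} := δN^r_j/δx^k − δN^r_k/δx^j`. -/
def Rspace (N : E n → Fin n → Fin n → ℝ) (r j k : Fin n) (p : E n) : ℝ :=
  dX N (fun q => N q j r) k p - dX N (fun q => N q k r) j p

/-- Second covariant derivative `X^i_{|j|k} := δ(X^i_{|j})/δx^k + Σ_r X^r_{|j} L^i_{rk}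
− Σ_r X^i_{|r} L^r_{jk}`. -/
def covXxX (N : E n → Fin n → Fin n → ℝ) (K : Conn n) (Xs : E n → Fin n → ℝ)
    (i j k : Fin n) (p : E n) : ℝ :=
  dX N (fun q => covXx N K Xs i j q) k p + (∑ r, covXx N K Xs r j p * K.L p i r k)
    - ∑ r, covXx N K Xs i r p * K.L p r j k

/-- The curvature d-tensor `R^i_{rjk} := δL^i_{rj}/δx^k − δL^i_{rk}/δx^j
+ Σ_s (L^s_{rj} L^i_{sk} − L^s_{rk} L^i_{sj}) + Σ_s C^i_{rs} R^s_{jk}`. -/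
def RspaceCurv (N : E n → Fin n → Fin n → ℝ) (K : Conn n) (i r j k : Fin n) (p : E n) : ℝ :=
  dX N (fun q => K.L q i r j) k p - dX N (fun q => K.L q i r k) j p
    + (∑ s, (K.L p s r j * K.L p i s k - K.L p s r k * K.L p i s j))
    + ∑ s, K.C p i r s * Rspace N s j k p

theorem fderiv_vertical_apply (f : E n → ℝ) (p : E n) (w : Fin n → ℝ) :
    fderiv ℝ f p (0, 0, w) = ∑ r, w r * pY f r p := by
  have h : ((0, 0, w) : E n) = ∑ r, w r • ((0, 0, Pi.single r 1) : E n) := by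
    ext s <;> simp [Prod.fst_sum, Prod.snd_sum, Finset.sum_apply, Pi.single_apply]
  simp only [h, map_sum, map_smul, smul_eq_mul, pY]

theorem dX_eq_fderiv_delX (N : E n → Fin n → Fin n → ℝ) (f : E n → ℝ) (i : Fin n) (p : E n) :
    dX N f i p = fderiv ℝ f p (delX N i p) := by
  have h : delX N i p = (0, Pi.single i 1, 0) + (0, 0, fun j => -(N p i j)) := by
    simp [delX]
  rw [h, map_add, fderiv_vertical_apply]
  simp [dX, pX, sub_eq_add_neg]

theorem fderiv_delX_apply {N : E n → Fin n → Fin n → ℝ} (hN : Differentiable ℝ N) (i : Fin n)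
    (p v : E n) :
    fderiv ℝ (delX N i) p v = (0, 0, fun r => -fderiv ℝ (fun q => N q i r) p v) := by
  have hcomp : ∀ r, DifferentiableAt ℝ (fun q => N q i r) p := fun r => by fun_prop
  have h3 : HasFDerivAt (fun q => fun r => -(N q i r))
      (ContinuousLinearMap.pi fun r => -fderiv ℝ (fun q => N q i r) p) p :=
    hasFDerivAt_pi.2 fun r => (hcomp r).hasFDerivAt.neg
  have h := (hasFDerivAt_const (0 : ℝ) p).prodMk
    ((hasFDerivAt_const (Pi.single i 1 : Fin n → ℝ) p).prodMk h3)
  have h' : fderiv ℝ (delX N i) p = _ := HasFDerivAt.fderiv h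
  rw [h']
  rfl

theorem differentiable_delX {N : E n → Fin n → Fin n → ℝ} (hN : Differentiable ℝ N) (i : Fin n) :
    Differentiable ℝ (delX N i) := by
  unfold delX
  fun_prop

theorem differentiable_dX {N : E n → Fin n → Fin n → ℝ} (hN : Differentiable ℝ N) {f : E n → ℝ}
    (hf : ContDiff ℝ 2 f) (i : Fin n) : Differentiable ℝ (fun q => dX N f i q) := by
  have hf' : Differentiable ℝ (fderiv ℝ f) :=
    (hf.fderiv_right (m := 1) (by norm_num)).differentiable (by norm_num)
  simp only [dX_eq_fderiv_delX]
  exact hf'.clm_apply (differentiable_delX hN i)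

theorem dX_dX {N : E n → Fin n → Fin n → ℝ} (hN : Differentiable ℝ N) {f : E n → ℝ}
    (hf : ContDiff ℝ 2 f) (j k : Fin n) (p : E n) :
    dX N (fun q => dX N f j q) k p =
      fderiv ℝ (fderiv ℝ f) p (delX N k p) (delX N j p)
        - ∑ r, dX N (fun q => N q j r) k p * pY f r p := by
  have hf' : Differentiable ℝ (fderiv ℝ f) :=
    (hf.fderiv_right (m := 1) (by norm_num)).differentiable (by norm_num)
  simp only [dX_eq_fderiv_delX]
  rw [fderiv_clm_apply (hf' p) (differentiable_delX hN j p)]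
  simp [fderiv_delX_apply hN, fderiv_vertical_apply]
  ring

/-- The bracket of two adapted spatial frame fields is vertical, with components `-R^r_{jk}`. -/
theorem dX_commutator {N : E n → Fin n → Fin n → ℝ} (hN : Differentiable ℝ N) {f : E n → ℝ}
    (hf : ContDiff ℝ 2 f) (j k : Fin n) (p : E n) :
    dX N (fun q => dX N f j q) k p - dX N (fun q => dX N f k q) j p =
      -∑ r, pY f r p * Rspace N r j k p := by
  have hs : IsSymmSndFDerivAt ℝ f p := hf.contDiffAt.isSymmSndFDerivAt (by simp)
  rw [dX_dX hN hf, dX_dX hN hf, hs.eq (delX N k p) (delX N j p)]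
  simp only [Rspace, mul_sub, Finset.sum_sub_distrib, mul_comm]
  ring

theorem dX_add {N : E n → Fin n → Fin n → ℝ} {f g : E n → ℝ} {p : E n}
    (hf : DifferentiableAt ℝ f p) (hg : DifferentiableAt ℝ g p) (i : Fin n) :
    dX N (fun q => f q + g q) i p = dX N f i p + dX N g i p := by
  simp only [dX_eq_fderiv_delX]
  rw [fderiv_fun_add hf hg]
  rfl

theorem dX_sum_mul {ι : Type*} (s : Finset ι) {N : E n → Fin n → Fin n → ℝ} {f g : ι → E n → ℝ}
    {p : E n} (hf : ∀ r ∈ s, DifferentiableAt ℝ (f r) p)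
    (hg : ∀ r ∈ s, DifferentiableAt ℝ (g r) p) (i : Fin n) :
    dX N (fun q => ∑ r ∈ s, f r q * g r q) i p =
      ∑ r ∈ s, (f r p * dX N (g r) i p + dX N (f r) i p * g r p) := by
  simp only [dX_eq_fderiv_delX]
  rw [fderiv_fun_sum fun r hr => (hf r hr).fun_mul (hg r hr)]
  rw [sum_apply]
  refine Finset.sum_congr rfl fun r hr => ?_
  rw [fderiv_fun_mul (hf r hr) (hg r hr)]
  simp [mul_comm]

/-- The derivative along `δ/δx^k` of the `j`-th spatial covariant derivative, expanded. -/
theorem dX_covXx {N : E n → Fin n → Fin n → ℝ} (hN : Differentiable ℝ N) {K : Conn n}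
    (hL : Differentiable ℝ K.L) {Xs : E n → Fin n → ℝ} (hXs : ContDiff ℝ 2 Xs)
    (i j k : Fin n) (p : E n) :
    dX N (fun q => covXx N K Xs i j q) k p =
      dX N (fun q => dX N (fun q => Xs q i) j q) k p
        + ∑ r, (Xs p r * dX N (fun q => K.L q i r j) k p
          + dX N (fun q => Xs q r) k p * K.L p i r j) := by
  have hX : Differentiable ℝ Xs := hXs.differentiable (by norm_num)
  have hXi : ContDiff ℝ 2 (fun q => Xs q i) := contDiff_pi.1 hXs i
  simp only [covXx]
  rw [dX_add (differentiable_dX hN hXi j p) (by fun_prop),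
    dX_sum_mul Finset.univ (f := fun r q => Xs q r) (g := fun r q => K.L q i r j)
      (fun r _ => by fun_prop) (fun r _ => by fun_prop)]

/-- Ricci identity, M-horizontal components, spatial–spatial derivatives:
`X^i_{|j|k} − X^i_{|k|j} = Σ_r X^r R^i_{rjk} − Σ_r X^i_{|r} T^r_{jk} − Σ_r X^i|_{(r)} R^r_{jk}`,
where `T^r_{jk} := L^r_{jk} − L^r_{kj}`. -/
theorem ricci_hM_space_space (n : ℕ) (M : E n → Fin n → ℝ) (N : E n → Fin n → Fin n → ℝ)
    (hM : ContDiff ℝ (⊤ : ℕ∞) M) (hN : ContDiff ℝ (⊤ : ℕ∞) N) (K : Conn n) (hK : K.Smooth)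
    (X1 : E n → ℝ) (Xs Xv : E n → Fin n → ℝ)
    (hX1 : ContDiff ℝ (⊤ : ℕ∞) X1) (hXs : ContDiff ℝ (⊤ : ℕ∞) Xs) (hXv : ContDiff ℝ (⊤ : ℕ∞) Xv)
    (i j k : Fin n) (p : E n) :
    covXxX N K Xs i j k p - covXxX N K Xs i k j p =
      (∑ r, Xs p r * RspaceCurv N K i r j k p)
        - (∑ r, covXx N K Xs i r p * (K.L p r j k - K.L p r k j))
        - ∑ r, covYx K Xs i r p * Rspace N r j k p := by
  obtain ⟨-, -, -, -, hL, -⟩ := hK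
  have hN' : Differentiable ℝ N := hN.differentiable (by simp)
  have hL' : Differentiable ℝ K.L := hL.differentiable (by simp)
  have hX2 : ContDiff ℝ 2 Xs := contDiff_infty.1 hXs 2
  have hcomm := dX_commutator hN' (contDiff_pi.1 hX2 i) j k p
  have hLL : ∀ a b : Fin n, ∑ r, (∑ s, Xs p s * K.L p r s a) * K.L p i r b =
      ∑ r, Xs p r * ∑ s, K.L p s r a * K.L p i s b := fun a b => by
    simp only [Finset.sum_mul, Finset.mul_sum]
    rw [Finset.sum_comm]
    simp only [mul_assoc]
  have hCR : ∑ r, (∑ s, Xs p s * K.C p i s r) * Rspace N r j k p =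
      ∑ r, Xs p r * ∑ s, K.C p i r s * Rspace N s j k p := by
    simp only [Finset.sum_mul, Finset.mul_sum]
    rw [Finset.sum_comm]
    simp only [mul_assoc]
  have hcov : ∀ a b : Fin n, ∑ r, covXx N K Xs r a p * K.L p i r b =
      (∑ r, dX N (fun q => Xs q r) a p * K.L p i r b)
        + ∑ r, Xs p r * ∑ s, K.L p s r a * K.L p i s b := fun a b => by
    rw [← hLL]
    simp only [covXx, add_mul, Finset.sum_add_distrib]
  have hcovY : ∑ r, covYx K Xs i r p * Rspace N r j k p =
      (∑ r, pY (fun q => Xs q i) r p * Rspace N r j k p)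
        + ∑ r, Xs p r * ∑ s, K.C p i r s * Rspace N s j k p := by
    rw [← hCR]
    simp only [covYx, add_mul, Finset.sum_add_distrib]
  rw [hcovY]
  unfold covXxX RspaceCurv
  rw [dX_covXx hN' hL' hX2, dX_covXx hN' hL' hX2, hcov, hcov]
  simp only [Finset.sum_sub_distrib, Finset.sum_add_distrib, mul_add, mul_sub]
  linarith
end
end
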